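/- arXiv:2511.02641 — 5 statements merged into one kernel-verified Lean document; each statement's English description precedes it below -/
import Mathlib

section
/- Let C be a cut of Q of type γ with B-periodic preimage Ĉ among the arrows of Q̂. For any two paths p and q in Q̂ having the same source and the same target, f_C(p) = f_C(q). -/
open scoped Classical

noncomputable section

namespace Paper

/-- The ambient lattice `ℤ^(d+1)`. -/
abbrev V (d : ℕ) : Type := Fin (d + 1) → ℤ

/-- The coordinate-sum homomorphism. -/
def sumHom (d : ℕ) : V d →+ ℤ :=
  AddMonoidHom.mk' (fun v => ∑ i, v i) (fun a b => by
    simp [Finset.sum_add_distrib])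

/-- The lattice `L` of integer vectors with coordinate sum zero. -/
def L (d : ℕ) : AddSubgroup (V d) := (sumHom d).ker

/-- `α i = e_i - e_{i-1}` (indices cyclic mod `d+1`), as an element of `L`. -/
def alpha (d : ℕ) (i : Fin (d + 1)) : L d :=
  ⟨Pi.single i 1 - Pi.single (i - 1) 1, by
    have : sumHom d (Pi.single i 1 - Pi.single (i - 1) 1) = 0 := by
      simp [sumHom, Finset.sum_sub_distrib, Pi.single_apply]
    exact this⟩

/-- Arrows of the infinite quiver `Q̂`: the pair (source, type); the arrow of type `i`
with source `x` goes from `x` to `x + α i`. -/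
abbrev ArrowHat (d : ℕ) : Type := L d × Fin (d + 1)

/-- Arrows of the quiver `Q` on `L/B`: the pair (source, type). -/
abbrev Arrow (d : ℕ) (B : AddSubgroup (L d)) : Type := (L d ⧸ B) × Fin (d + 1)

/-- The preimage among arrows of `Q̂` of a set of arrows of `Q`. -/
def preim (d : ℕ) (B : AddSubgroup (L d)) (C : Set (Arrow d B)) : Set (ArrowHat d) :=
  {a | ((QuotientAddGroup.mk a.1 : L d ⧸ B), a.2) ∈ C}

/-- A set of arrows of `Q̂` is a cut if it contains exactly one arrow of every elementary
cycle.  Elementary cycles are exactly the cyclic paths of length `d+1` with pairwise distinct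
types; they are parametrized by a starting vertex `x` and a permutation `σ` of the types,
the `k`-th arrow being the type-`σ k` arrow with source `x + ∑_{j<k} α (σ j)`. -/
def IsCutHat (d : ℕ) (Ch : Set (ArrowHat d)) : Prop :=
  ∀ (x : L d) (σ : Equiv.Perm (Fin (d + 1))),
    ∃! k : Fin (d + 1), (x + ∑ j ∈ Finset.Iio k, alpha d (σ j), σ k) ∈ Ch

/-- A set of arrows of `Q̂` is `B`-periodic if it is invariant under translation by `B`. -/
def IsBPeriodic (d : ℕ) (B : AddSubgroup (L d)) (Ch : Set (ArrowHat d)) : Prop :=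
  ∀ (a : ArrowHat d) (b : L d), b ∈ B → ((a.1 + b, a.2) ∈ Ch ↔ a ∈ Ch)

/-- A set of arrows of `Q` is a cut if its preimage among the arrows of `Q̂` is a cut. -/
def IsCut (d : ℕ) (B : AddSubgroup (L d)) (C : Set (Arrow d B)) : Prop :=
  IsCutHat d (preim d B C)

/-- The type of a cut of `Q`: the `i`-th entry is the number of arrows of type `i` in it. -/
def cutType (d : ℕ) (B : AddSubgroup (L d)) (C : Set (Arrow d B)) : Fin (d + 1) → ℤ :=
  fun i => (Nat.card {v : L d ⧸ B // (v, i) ∈ C} : ℤ)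

/-- A cut detector of type `γ`. -/
def IsCutDetector (d : ℕ) (B : AddSubgroup (L d)) (f : L d ⧸ B → ℤ)
    (γ : Fin (d + 1) → ℤ) : Prop :=
  f 0 = 0 ∧ ∀ (x : L d) (i : Fin (d + 1)),
    f (QuotientAddGroup.mk (x + alpha d i)) = f (QuotientAddGroup.mk x) + γ i ∨
    f (QuotientAddGroup.mk (x + alpha d i)) = f (QuotientAddGroup.mk x) + γ i - (B.index : ℤ)

/-- The value `f_C` of an arrow of `Q̂`: `γ i - m` if the arrow lies in the given set of
arrows, and `γ i` otherwise (for an arrow of type `i`). -/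
def arrowVal (d : ℕ) (Ch : Set (ArrowHat d)) (γ : Fin (d + 1) → ℤ) (m : ℤ)
    (a : ArrowHat d) : ℤ :=
  if a ∈ Ch then γ a.2 - m else γ a.2

/-- The value `f_C` of a path in `Q̂`, the path being recorded as its list of types together
with its source: the sum of the values of its arrows. -/
def pathVal (d : ℕ) (Ch : Set (ArrowHat d)) (γ : Fin (d + 1) → ℤ) (m : ℤ) :
    List (Fin (d + 1)) → L d → ℤ
  | [], _ => 0
  | i :: p, x => arrowVal d Ch γ m (x, i) + pathVal d Ch γ m p (x + alpha d i)

/-- `f` is the function `f̄_C` induced by `f_C` on `L/B`:  for every `x ∈ L` and every path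
`p` in `Q̂` from `0` to `x`, `f(x + B)` is the value of `p`. -/
def Detects (d : ℕ) (B : AddSubgroup (L d)) (C : Set (Arrow d B)) (γ : Fin (d + 1) → ℤ)
    (f : L d ⧸ B → ℤ) : Prop :=
  ∀ (x : L d) (p : List (Fin (d + 1))), (p.map (alpha d)).sum = x →
    f (QuotientAddGroup.mk x) = pathVal d (preim d B C) γ (B.index : ℤ) p 0

/-- The set of arrows `C_f` of `Q` associated to a function `f : L/B → ℤ` (of type `γ`):
the arrows `x + B → x + α i + B` with `f(x + α i + B) = f(x + B) + γ i - m`. -/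
def cutOf (d : ℕ) (B : AddSubgroup (L d)) (f : L d ⧸ B → ℤ) (γ : Fin (d + 1) → ℤ) :
    Set (Arrow d B) :=
  {a | ∃ x : L d, QuotientAddGroup.mk x = a.1 ∧
      f (QuotientAddGroup.mk (x + alpha d a.2)) = f a.1 + γ a.2 - (B.index : ℤ)}


/-- A path in the quiver `Q_C = Q ∖ C`, recorded as its list of types plus its source:
all its arrows avoid `C`. -/
def avoids (d : ℕ) (B : AddSubgroup (L d)) (C : Set (Arrow d B)) :
    List (Fin (d + 1)) → (L d ⧸ B) → Prop
  | [], _ => True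
  | i :: p, v => (v, i) ∉ C ∧ avoids d B C p (v + QuotientAddGroup.mk (alpha d i))

/-- A cut `C` of `Q` is bounding if the quiver `Q_C` obtained by deleting the arrows of `C`
has no cyclic path of positive length. -/
def IsBounding (d : ℕ) (B : AddSubgroup (L d)) (C : Set (Arrow d B)) : Prop :=
  ¬ ∃ (v : L d ⧸ B) (p : List (Fin (d + 1))), p ≠ [] ∧ avoids d B C p v ∧
      v + QuotientAddGroup.mk ((p.map (alpha d)).sum) = v

/-- The homomorphism `Φ : ℤ^(d+1) → ℤ ⊕ L/B` with `Φ(e_i) = (γ_i, α_i + B)`. -/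
def Phi (d : ℕ) (B : AddSubgroup (L d)) (γ : Fin (d + 1) → ℤ) :
    V d →+ ℤ × (L d ⧸ B) :=
  AddMonoidHom.mk'
    (fun v => (∑ i, v i * γ i, QuotientAddGroup.mk (∑ i, v i • alpha d i)))
    (fun a b => by
      have h1 : ∑ i, (a + b) i * γ i = (∑ i, a i * γ i) + ∑ i, b i * γ i := by
        rw [← Finset.sum_add_distrib]
        exact Finset.sum_congr rfl fun i _ => by simp [add_mul]
      have h2 : (∑ i, (a + b) i • alpha d i) =
          (∑ i, a i • alpha d i) + ∑ i, b i • alpha d i := by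
        rw [← Finset.sum_add_distrib]
        exact Finset.sum_congr rfl fun i _ => by simp [add_smul]
      show (∑ i, (a + b) i * γ i, QuotientAddGroup.mk (∑ i, (a + b) i • alpha d i)) =
        ((∑ i, a i * γ i, QuotientAddGroup.mk (∑ i, a i • alpha d i)) : ℤ × (L d ⧸ B)) +
          (∑ i, b i * γ i, QuotientAddGroup.mk (∑ i, b i • alpha d i))
      rw [Prod.mk_add_mk, h1, h2, QuotientAddGroup.mk_add])

/-- The group `G(B,γ)`, the image of `Φ`. -/
abbrev GB (d : ℕ) (B : AddSubgroup (L d)) (γ : Fin (d + 1) → ℤ) :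
    AddSubgroup (ℤ × (L d ⧸ B)) :=
  (Phi d B γ).range

/-- The element `x_i = Φ(e_i)` of `G(B,γ)`. -/
def xE (d : ℕ) (B : AddSubgroup (L d)) (γ : Fin (d + 1) → ℤ) (i : Fin (d + 1)) :
    GB d B γ :=
  ⟨Phi d B γ (Pi.single i 1), ⟨Pi.single i 1, rfl⟩⟩

/-- The element `p = ∑ x_i` of `G(B,γ)`. -/
def pE (d : ℕ) (B : AddSubgroup (L d)) (γ : Fin (d + 1) → ℤ) : GB d B γ :=
  ∑ i, xE d B γ i

/-- Membership in `𝒥`: `J` contains exactly one element of every coset of `ℤp`, and for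
`g ∈ J` and every `i`, `g + x_i ∈ J ∪ (J + p)`. -/
def InJ (d : ℕ) (B : AddSubgroup (L d)) (γ : Fin (d + 1) → ℤ)
    (J : Set (GB d B γ)) : Prop :=
  (∀ g : GB d B γ, ∃! n : ℤ, g + n • pE d B γ ∈ J) ∧
    ∀ g ∈ J, ∀ i : Fin (d + 1), g + xE d B γ i ∈ J ∨ g + xE d B γ i - pE d B γ ∈ J

/-- `f` is the function `f_J : L/B → ℤ` attached to `J ∈ 𝒥`:  whenever `n_J • p ∈ J`
and `g ∈ J`, the value of `f` at the image of `g` under the second projection is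
`π₁(g) - n_J · m`. -/
def IsFJ (d : ℕ) (B : AddSubgroup (L d)) (γ : Fin (d + 1) → ℤ)
    (J : Set (GB d B γ)) (f : L d ⧸ B → ℤ) : Prop :=
  ∀ n : ℤ, n • pE d B γ ∈ J → ∀ g ∈ J,
    f (g : ℤ × (L d ⧸ B)).2 = (g : ℤ × (L d ⧸ B)).1 - n * (B.index : ℤ)

/-- The cone of nonnegative integer combinations of the `x i`. -/
def cone {G : Type*} [AddCommGroup G] {n : ℕ} (x : Fin n → G) : Set G :=
  {g | ∃ c : Fin n → ℕ, g = ∑ i, (c i : ℤ) • x i}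

/-- Upper sets for the partial order `g ≤ h ↔ h - g ∈ cone x`. -/
def IsUpper {G : Type*} [AddCommGroup G] {n : ℕ} (x : Fin n → G) (I : Set G) : Prop :=
  ∀ g ∈ I, ∀ h : G, h - g ∈ cone x → h ∈ I

/-- `J(I) = I ∩ (Iᶜ + p)`. -/
def JofI {G : Type*} [AddCommGroup G] (p : G) (I : Set G) : Set G :=
  {g | g ∈ I ∧ g - p ∉ I}

/-- The set `𝒥̃` of subsets `J` with `g ≱ h + p` for all `g, h ∈ J` (where `p = ∑ x i`). -/
def tilJSet {G : Type*} [AddCommGroup G] {n : ℕ} (x : Fin n → G) : Set (Set G) :=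
  {J | ∀ g ∈ J, ∀ h ∈ J, g - (h + ∑ i, x i) ∉ cone x}

/-- The homomorphism `ℤ^(d+1) → G` sending `e_i` to `x i`. -/
def PhiG {G : Type*} [AddCommGroup G] (d : ℕ) (x : Fin (d + 1) → G) : V d →+ G :=
  AddMonoidHom.mk' (fun v => ∑ i, v i • x i) (fun a b => by
    rw [← Finset.sum_add_distrib]
    exact Finset.sum_congr rfl fun i _ => by simp [add_smul])

/-- A finitely generated abelian group of rank one with elements `x_0, …, x_d`
satisfying (G1), (G2), (G3).  (Rank one is expressed by the existence of a surjective
homomorphism to `ℤ` whose kernel is exactly the torsion.) -/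
def GoodPair (d : ℕ) (G : Type*) [AddCommGroup G] (x : Fin (d + 1) → G) : Prop :=
  AddGroup.FG G ∧
  (∃ π' : G →+ ℤ, Function.Surjective π' ∧ ∀ g : G, π' g = 0 ↔ IsOfFinAddOrder g) ∧
  (∀ i, x i ≠ 0) ∧
  (∀ g : G, ∃ c : Fin (d + 1) → ℤ, g = ∑ i, c i • x i) ∧
  (∀ g : G, g ∈ cone x → -g ∈ cone x → g = 0)

/-- A pair `(B, γ)` of a finite-index subgroup `B ⊆ L` and a positive integer vector `γ`
satisfying the two conditions of Theorem `chartype`. -/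
def GoodBgamma (d : ℕ) (B : AddSubgroup (L d)) (γ : Fin (d + 1) → ℤ) : Prop :=
  B.FiniteIndex ∧ (∀ i, 0 < γ i) ∧ (∑ i, γ i) = (B.index : ℤ) ∧
    ∀ m' : Fin (d + 1) → ℤ, (∑ i, m' i • alpha d i) ∈ B →
      (B.index : ℤ) ∣ ∑ i, m' i * γ i

theorem pathVal_append (d : ℕ) (Ch : Set (ArrowHat d)) (γ : Fin (d + 1) → ℤ) (m : ℤ)
    (p q : List (Fin (d + 1))) (x : L d) :
    pathVal d Ch γ m (p ++ q) x =
      pathVal d Ch γ m p x + pathVal d Ch γ m q (x + (p.map (alpha d)).sum) := by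
  induction p generalizing x with
  | nil => simp [pathVal]
  | cons i p ih =>
    simp only [List.cons_append, pathVal, ih, List.map_cons, List.sum_cons]
    rw [add_assoc x, add_assoc]

theorem pathVal_ofFn (d : ℕ) (Ch : Set (ArrowHat d)) (γ : Fin (d + 1) → ℤ) (m : ℤ)
    (n : ℕ) (g : Fin n → Fin (d + 1)) (x : L d) :
    pathVal d Ch γ m (List.ofFn g) x =
      ∑ k, arrowVal d Ch γ m (x + ∑ j ∈ Finset.Iio k, alpha d (g j), g k) := by
  induction n generalizing x with
  | zero => simp [pathVal]
  | succ n ih =>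
    rw [List.ofFn_succ, pathVal, ih, Fin.sum_univ_succ]
    congr 1
    · have h0 : Finset.Iio (0 : Fin (n + 1)) = ∅ := by
        ext a; simp
      rw [h0]; simp
    · refine Finset.sum_congr rfl fun k _ => ?_
      have h1 : Finset.Iio k.succ = insert 0 ((Finset.Iio k).map (Fin.succEmb n)) := by
        ext a
        refine Fin.cases ?_ (fun b => ?_) a <;> simp [Fin.succ_ne_zero]
      rw [h1, Finset.sum_insert (by simp [Fin.succ_ne_zero]), Finset.sum_map]
      simp [add_assoc]

theorem pathVal_perm_univ (d : ℕ) (Ch : Set (ArrowHat d)) (hC : IsCutHat d Ch)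
    (γ : Fin (d + 1) → ℤ) (m : ℤ) (l : List (Fin (d + 1))) (hl : l.Nodup)
    (hmem : ∀ i, i ∈ l) (x : L d) :
    pathVal d Ch γ m l x = (∑ i, γ i) - m := by
  have hlen : l.length = d + 1 := by
    have h1 := List.toFinset_card_of_nodup hl
    have h2 : l.toFinset = Finset.univ := by ext a; simp [hmem a]
    rw [h2] at h1; simpa using h1.symm
  let g : Fin (d + 1) → Fin (d + 1) := fun k => l.get (k.cast hlen.symm)
  have hg : Function.Injective g := by
    intro a b hab
    have := (List.nodup_iff_injective_get.1 hl) hab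
    simpa using this
  have hl2 : l = List.ofFn g := by
    apply List.ext_getElem
    · simp [hlen]
    · intro n h1 h2
      rw [List.getElem_ofFn]; rfl
  let σ : Equiv.Perm (Fin (d + 1)) := Equiv.ofBijective g (Finite.injective_iff_bijective.1 hg)
  have hσ : ∀ k, g k = σ k := fun k => rfl
  rw [hl2, pathVal_ofFn]
  obtain ⟨k0, hk0, huniq⟩ := hC x σ
  have hval : ∀ k, arrowVal d Ch γ m (x + ∑ j ∈ Finset.Iio k, alpha d (g j), g k)
      = γ (σ k) - (if k = k0 then m else 0) := by
    intro k
    unfold arrowVal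
    by_cases hk : k = k0
    · subst hk
      rw [if_pos (by simpa only [hσ] using hk0)]; simp [hσ]
    · rw [if_neg (fun h => hk (huniq k (by simpa only [hσ] using h)))]; simp [hσ, hk]
  rw [Finset.sum_congr rfl fun k _ => hval k, Finset.sum_sub_distrib, Equiv.sum_comp σ γ]
  simp

theorem pathVal_swap (d : ℕ) (Ch : Set (ArrowHat d)) (hC : IsCutHat d Ch)
    (γ : Fin (d + 1) → ℤ) (m : ℤ) (i j : Fin (d + 1)) (x : L d) :
    pathVal d Ch γ m [i, j] x = pathVal d Ch γ m [j, i] x := by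
  by_cases hij : i = j
  · rw [hij]
  let r := ((Finset.univ.erase i).erase j).toList
  have hr : r.Nodup := Finset.nodup_toList _
  have hm : ∀ a, a ∈ r ↔ a ≠ j ∧ a ≠ i := by intro a; simp [r]
  have h1 := pathVal_perm_univ d Ch hC γ m ([i, j] ++ r)
    (by simp [hr, hm, hij]) (by intro a; simp [hm]; tauto) x
  have h2 := pathVal_perm_univ d Ch hC γ m ([j, i] ++ r)
    (by simp [hr, hm, Ne.symm hij]) (by intro a; simp [hm]; tauto) x
  rw [pathVal_append] at h1 h2
  have h3 : (([i, j] : List (Fin (d + 1))).map (alpha d)).sum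
      = (([j, i] : List (Fin (d + 1))).map (alpha d)).sum := by
    simp [add_comm]
  rw [h3] at h1
  linarith

theorem pathVal_perm (d : ℕ) (Ch : Set (ArrowHat d)) (hC : IsCutHat d Ch)
    (γ : Fin (d + 1) → ℤ) (m : ℤ) (p q : List (Fin (d + 1))) (hpq : p.Perm q) :
    ∀ x, pathVal d Ch γ m p x = pathVal d Ch γ m q x := by
  induction hpq with
  | nil => intro x; rfl
  | cons a _ ih => intro x; simp only [pathVal, ih]
  | swap a b l =>
    intro x
    have h := pathVal_append d Ch γ m [b, a] l x
    have h' := pathVal_append d Ch γ m [a, b] l x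
    have h3 : (([a, b] : List (Fin (d + 1))).map (alpha d)).sum
        = (([b, a] : List (Fin (d + 1))).map (alpha d)).sum := by
      simp [add_comm]
    rw [h3, pathVal_swap d Ch hC γ m a b] at h'
    exact h.trans h'.symm
  | trans _ _ ih1 ih2 => intro x; rw [ih1, ih2]

theorem sum_cutType (d : ℕ) (B : AddSubgroup (L d)) [B.FiniteIndex] (C : Set (Arrow d B))
    (hC : IsCut d B C) : ∑ i, cutType d B C i = (B.index : ℤ) := by
  haveI : Fintype (L d ⧸ B) := Fintype.ofFinite _
  let s : Fin (d + 1) → L d ⧸ B := fun k => 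
    QuotientAddGroup.mk (∑ j ∈ Finset.Iio k, alpha d j)
  have h1 : ∀ i, cutType d B C i = ∑ v : L d ⧸ B, if (v + s i, i) ∈ C then (1 : ℤ) else 0 := by
    intro i
    refine Eq.trans ?_ (Equiv.sum_comp (Equiv.addRight (s i))
      (fun v => if (v, i) ∈ C then (1 : ℤ) else 0)).symm
    simp [cutType, Nat.card_eq_fintype_card, Fintype.card_subtype]
  have h2 : ∀ v : L d ⧸ B, ∑ i, (if (v + s i, i) ∈ C then (1 : ℤ) else 0) = 1 := by
    intro v
    obtain ⟨x, rfl⟩ := QuotientAddGroup.mk_surjective v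
    obtain ⟨k0, hk0, huniq⟩ := hC x (Equiv.refl _)
    have : ∀ i, (if ((QuotientAddGroup.mk x : L d ⧸ B) + s i, i) ∈ C then (1 : ℤ) else 0)
        = if i = k0 then 1 else 0 := by
      intro i
      by_cases hk : i = k0
      · subst hk
        have hk1 : ((QuotientAddGroup.mk x : L d ⧸ B) + s i, i) ∈ C := hk0
        rw [if_pos hk1, if_pos rfl]
      · have hk1 : ((QuotientAddGroup.mk x : L d ⧸ B) + s i, i) ∉ C := fun h => hk (huniq i h)
        rw [if_neg hk1, if_neg hk]
    rw [Finset.sum_congr rfl fun i _ => this i]; simp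
  rw [Finset.sum_congr rfl fun i _ => h1 i, Finset.sum_comm, Finset.sum_congr rfl fun v _ => h2 v]
  simp [AddSubgroup.index, Nat.card_eq_fintype_card]

theorem sum_alpha_apply (d : ℕ) (p : List (Fin (d + 1))) (i : Fin (d + 1)) :
    (((p.map (alpha d)).sum : L d) : V d) i = (p.count i : ℤ) - (p.count (i + 1) : ℤ) := by
  induction p with
  | nil => simp
  | cons a p ih =>
    simp only [List.map_cons, List.sum_cons, AddSubgroup.coe_add, Pi.add_apply, ih,
      List.count_cons, alpha, Pi.sub_apply, Pi.single_apply, beq_iff_eq]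
    have e1 : (i = a) = (a = i) := propext eq_comm
    have e2 : (i = a - 1) = (a = i + 1) := propext (by rw [eq_sub_iff_add_eq]; exact eq_comm)
    simp only [e1, e2]
    push_cast
    ring

theorem pathVal_cycles (d : ℕ) (Ch : Set (ArrowHat d)) (hC : IsCutHat d Ch)
    (γ : Fin (d + 1) → ℤ) (m : ℤ) (hm : ∑ i, γ i = m) (k : ℕ) (x : L d) :
    pathVal d Ch γ m (List.replicate k (List.finRange (d + 1))).flatten x = 0 := by
  induction k generalizing x with
  | zero => simp [pathVal]
  | succ k ih =>
    rw [List.replicate_succ, List.flatten_cons, pathVal_append, ih,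
      pathVal_perm_univ d Ch hC γ m _ (List.nodup_finRange _) (by simp), hm]
    simp

theorem pathVal_aux (d : ℕ) (Ch : Set (ArrowHat d)) (hC : IsCutHat d Ch)
    (γ : Fin (d + 1) → ℤ) (m : ℤ) (hm : ∑ i, γ i = m) (x : L d)
    (p q : List (Fin (d + 1))) (k : ℕ) (h : ∀ i, p.count i = q.count i + k) :
    pathVal d Ch γ m p x = pathVal d Ch γ m q x := by
  have hp : p.Perm (q ++ (List.replicate k (List.finRange (d + 1))).flatten) := by
    rw [List.perm_iff_count]
    intro a
    rw [h a, List.count_append, List.count_flatten, List.map_replicate,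
      List.count_eq_one_of_mem (List.nodup_finRange _) (List.mem_finRange a)]
    simp
  rw [pathVal_perm d Ch hC γ m _ _ hp, pathVal_append, pathVal_cycles d Ch hC γ m hm, add_zero]

theorem pathVal_eq_of_same_source_target (d : ℕ) (hd : 1 ≤ d) (B : AddSubgroup (L d))
    [B.FiniteIndex] (γ : Fin (d + 1) → ℤ) (C : Set (Arrow d B))
    (hC : IsCut d B C) (htype : cutType d B C = γ)
    (x : L d) (p q : List (Fin (d + 1)))
    (hpq : (p.map (alpha d)).sum = (q.map (alpha d)).sum) :
    pathVal d (preim d B C) γ (B.index : ℤ) p x =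
      pathVal d (preim d B C) γ (B.index : ℤ) q x := by
  have hm : ∑ i, γ i = (B.index : ℤ) := by
    rw [← htype]; exact sum_cutType d B C hC
  have hstep : ∀ i : Fin (d + 1), (p.count (i + 1) : ℤ) - q.count (i + 1)
      = (p.count i : ℤ) - q.count i := by
    intro i
    have h1 := sum_alpha_apply d p i
    have h2 := sum_alpha_apply d q i
    rw [hpq] at h1
    linarith
  have hconst : ∀ i : Fin (d + 1), (p.count i : ℤ) - q.count i
      = (p.count 0 : ℤ) - q.count 0 := by
    intro i
    induction i using Fin.induction with
    | zero => rfl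
    | succ i ih =>
      rw [← ih, ← hstep i.castSucc, Fin.coeSucc_eq_succ]
  rcases le_total (q.count 0) (p.count 0) with h0 | h0
  · exact pathVal_aux d _ hC γ _ hm x p q (p.count 0 - q.count 0)
      (fun i => by have := hconst i; omega)
  · exact (pathVal_aux d _ hC γ _ hm x q p (q.count 0 - p.count 0)
      (fun i => by have := hconst i; omega)).symm

end Paper
end
end

section
/- Let C be a cut of Q of type γ. Then f_C : L → ℤ is invariant under translation by B, i.e., f_C(x + y) = f_C(x) for all x ∈ L and y ∈ B (in particular f_C(y) = 0 for all y ∈ B); consequently f_C induces a map f̄_C : L/B → ℤ, and f̄_C is a cut detector of type γ. -/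
open scoped Classical

noncomputable section

namespace Paper

/-- Indicator version of the cut property. -/
lemma aux_cut_sum {d : ℕ} {Ch : Set (ArrowHat d)} (h : IsCutHat d Ch) (x : L d)
    (σ : Equiv.Perm (Fin (d + 1))) :
    ∑ k : Fin (d + 1),
      (if (x + ∑ j ∈ Finset.Iio k, alpha d (σ j), σ k) ∈ Ch then (1 : ℤ) else 0) = 1 := by
  obtain ⟨k, hk, huniq⟩ := h x σ
  rw [Finset.sum_eq_single k]
  · exact if_pos hk
  · intro b _ hb
    exact if_neg fun hmem => hb (huniq b hmem)
  · intro hk'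
    exact absurd (Finset.mem_univ k) hk'

lemma aux_exists_perm {n : ℕ} {i j : Fin (n + 2)} (hij : i ≠ j) :
    ∃ σ : Equiv.Perm (Fin (n + 2)), σ 0 = i ∧ σ 1 = j := by
  refine ⟨Equiv.swap (Equiv.swap 0 i 1) j * Equiv.swap 0 i, ?_, ?_⟩
  · rw [Equiv.Perm.mul_apply, Equiv.swap_apply_left]
    apply Equiv.swap_apply_of_ne_of_ne _ hij
    intro h
    have h2 : Equiv.swap 0 i 0 = Equiv.swap 0 i 1 := by
      rw [Equiv.swap_apply_left]; exact h
    have := (Equiv.swap (0 : Fin (n + 2)) i).injective h2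
    simp at this
  · rw [Equiv.Perm.mul_apply, Equiv.swap_apply_left]

lemma aux_comm {d : ℕ} (hd : 1 ≤ d) {Ch : Set (ArrowHat d)} (h : IsCutHat d Ch) (x : L d)
    (i j : Fin (d + 1)) :
    (if (x, i) ∈ Ch then (1 : ℤ) else 0) + (if (x + alpha d i, j) ∈ Ch then (1 : ℤ) else 0) =
    (if (x, j) ∈ Ch then (1 : ℤ) else 0) + (if (x + alpha d j, i) ∈ Ch then (1 : ℤ) else 0) := by
  by_cases hij : i = j
  · subst hij; rfl
  obtain ⟨n, rfl⟩ : ∃ n, d = n + 1 := ⟨d - 1, by omega⟩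
  obtain ⟨σ, h0, h1⟩ := aux_exists_perm hij
  have e1 := aux_cut_sum h x σ
  set τ : Equiv.Perm (Fin (n + 1 + 1)) := σ * Equiv.swap 0 1 with hτ
  have e2 := aux_cut_sum h x τ
  rw [Fin.sum_univ_succ, Fin.sum_univ_succ] at e1 e2
  have hI0 : Finset.Iio (0 : Fin (n + 1 + 1)) = ∅ := by
    ext a; simp
  have hI1 : Finset.Iio (Fin.succ (0 : Fin (n + 1))) = {0} := by
    ext a; rw [Finset.mem_Iio, Finset.mem_singleton, Fin.lt_def, Fin.ext_iff]; simp
  have hrest : ∀ k : Fin n,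
      (∑ l ∈ Finset.Iio k.succ.succ, alpha (n + 1) (τ l))
        = ∑ l ∈ Finset.Iio k.succ.succ, alpha (n + 1) (σ l) := by
    intro k
    refine Finset.sum_equiv (Equiv.swap 0 1) ?_ ?_
    · intro l
      by_cases hl0 : l = 0
      · subst hl0; simp [Fin.lt_def]
      by_cases hl1 : l = 1
      · subst hl1; simp [Fin.lt_def]
      rw [Equiv.swap_apply_of_ne_of_ne hl0 hl1]
    · intro l _; rfl
  have hk : ∀ k : Fin n, τ k.succ.succ = σ k.succ.succ := by
    intro k
    rw [hτ, Equiv.Perm.mul_apply, Equiv.swap_apply_of_ne_of_ne]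
    · exact Fin.succ_ne_zero _
    · intro hh
      simp [Fin.ext_iff] at hh
  simp only [hrest, hk, hI0, hI1, Finset.sum_empty, Finset.sum_singleton, add_zero] at e1 e2
  have s0 : τ 0 = j := by simp [hτ, h1]
  have s1 : τ (Fin.succ 0) = i := by simp [hτ, h0]
  have s2 : σ (Fin.succ 0) = j := by simpa using h1
  rw [h0, s2] at e1
  rw [s0, s1] at e2
  linarith

/-- Arrow value on the quotient. -/
def aV (d : ℕ) (B : AddSubgroup (L d)) (C : Set (Arrow d B)) (γ : Fin (d + 1) → ℤ)
    (v : L d ⧸ B) (i : Fin (d + 1)) : ℤ :=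
  γ i - (B.index : ℤ) * (if (v, i) ∈ C then 1 else 0)

/-- Path value on the quotient. -/
def pV (d : ℕ) (B : AddSubgroup (L d)) (C : Set (Arrow d B)) (γ : Fin (d + 1) → ℤ) :
    List (Fin (d + 1)) → (L d ⧸ B) → ℤ
  | [], _ => 0
  | i :: p, v => aV d B C γ v i + pV d B C γ p (v + QuotientAddGroup.mk (alpha d i))

lemma pathVal_eq {d : ℕ} (B : AddSubgroup (L d)) (C : Set (Arrow d B)) (γ : Fin (d + 1) → ℤ)
    (p : List (Fin (d + 1))) (x : L d) :
    pathVal d (preim d B C) γ (B.index : ℤ) p x = pV d B C γ p (QuotientAddGroup.mk x) := by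
  induction p generalizing x with
  | nil => rfl
  | cons i p ih =>
    simp only [pathVal, pV, ih, QuotientAddGroup.mk_add]
    congr 1
    have hm : (x, i) ∈ preim d B C ↔ ((QuotientAddGroup.mk x : L d ⧸ B), i) ∈ C := Iff.rfl
    simp only [arrowVal, aV]
    by_cases h : ((QuotientAddGroup.mk x : L d ⧸ B), i) ∈ C
    · rw [if_pos (hm.2 h), if_pos h]; ring
    · rw [if_neg (fun h' => h (hm.1 h')), if_neg h]; ring

lemma pV_append {d : ℕ} (B : AddSubgroup (L d)) (C : Set (Arrow d B)) (γ : Fin (d + 1) → ℤ)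
    (p q : List (Fin (d + 1))) (v : L d ⧸ B) :
    pV d B C γ (p ++ q) v =
      pV d B C γ p v + pV d B C γ q (v + QuotientAddGroup.mk ((p.map (alpha d)).sum)) := by
  induction p generalizing v with
  | nil => simp [pV]
  | cons i p ih =>
    simp only [List.cons_append, pV, ih, List.map_cons, List.sum_cons, QuotientAddGroup.mk_add]
    rw [add_assoc, add_assoc]

lemma aV_comm {d : ℕ} (hd : 1 ≤ d) {B : AddSubgroup (L d)} {C : Set (Arrow d B)}
    (γ : Fin (d + 1) → ℤ) (hC : IsCut d B C) (v : L d ⧸ B) (i j : Fin (d + 1)) :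
    aV d B C γ v i + aV d B C γ (v + QuotientAddGroup.mk (alpha d i)) j =
    aV d B C γ v j + aV d B C γ (v + QuotientAddGroup.mk (alpha d j)) i := by
  induction v using QuotientAddGroup.induction_on with
  | H x =>
    have this : (if ((x : L d ⧸ B), i) ∈ C then (1 : ℤ) else 0) +
        (if ((x : L d ⧸ B) + QuotientAddGroup.mk (alpha d i), j) ∈ C then (1 : ℤ) else 0) =
        (if ((x : L d ⧸ B), j) ∈ C then (1 : ℤ) else 0) +
        (if ((x : L d ⧸ B) + QuotientAddGroup.mk (alpha d j), i) ∈ C then (1 : ℤ) else 0) :=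
      aux_comm hd hC x i j
    simp only [aV]
    linear_combination (-(B.index : ℤ)) * this

lemma pV_perm {d : ℕ} (hd : 1 ≤ d) {B : AddSubgroup (L d)} {C : Set (Arrow d B)}
    (γ : Fin (d + 1) → ℤ) (hC : IsCut d B C) {p q : List (Fin (d + 1))} (h : p.Perm q)
    (v : L d ⧸ B) : pV d B C γ p v = pV d B C γ q v := by
  induction h generalizing v with
  | nil => rfl
  | cons i _ ih => simp only [pV, ih]
  | swap i j l =>
    simp only [pV]
    have := aV_comm hd γ hC v i j
    rw [add_right_comm v]
    linarith
  | trans _ _ ih1 ih2 => rw [ih1, ih2]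

lemma exists_path {d : ℕ} (x : L d) : ∃ p : List (Fin (d + 1)), (p.map (alpha d)).sum = x := by
  have hsum : ∑ i, alpha d i = 0 := by
    apply Subtype.ext
    rw [AddSubgroup.val_finsetSum]
    simp only [alpha, Finset.sum_sub_distrib]
    have := Equiv.sum_comp (Equiv.subRight (1 : Fin (d + 1)))
      (fun i => (Pi.single i 1 : V d))
    simp only [Equiv.subRight_apply] at this
    rw [this]; simp
  set S := AddSubmonoid.closure (Set.range (alpha d)) with hS
  have hmem : ∀ i, alpha d i ∈ S := fun i => AddSubmonoid.subset_closure ⟨i, rfl⟩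
  have hneg : ∀ i, -alpha d i ∈ S := by
    intro i
    have : -alpha d i = ∑ j ∈ Finset.univ.erase i, alpha d j := by
      rw [neg_eq_iff_add_eq_zero, Finset.add_sum_erase _ _ (Finset.mem_univ i), hsum]
    rw [this]
    exact sum_mem fun j _ => hmem j
  have hz : ∀ (c : ℤ) i, c • alpha d i ∈ S := by
    intro c i
    obtain ⟨n, rfl | rfl⟩ := c.eq_nat_or_neg
    · rw [natCast_zsmul]; exact nsmul_mem (hmem i) n
    · rw [neg_smul, natCast_zsmul, ← smul_neg]; exact nsmul_mem (hneg i) n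
  have hx0 : ∑ i, x.1 i = 0 := x.2
  have hx : x = ∑ i, (∑ j ∈ Finset.Ici i, x.1 j) • alpha d i := by
    apply Subtype.ext
    rw [AddSubgroup.val_finsetSum]
    funext k
    rw [Finset.sum_apply]
    have e : ∀ i, ((((∑ j ∈ Finset.Ici i, x.1 j) • alpha d i : L d) : V d) k) =
        (∑ j ∈ Finset.Ici i, x.1 j) * (if k = i then 1 else 0) -
        (∑ j ∈ Finset.Ici i, x.1 j) * (if i = k + 1 then 1 else 0) := by
      intro i
      have : k = i - 1 ↔ i = k + 1 := by
        constructor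
        · rintro rfl; simp
        · rintro rfl; simp
      simp [alpha, Pi.single_apply, this, mul_sub]
    simp only [e, Finset.sum_sub_distrib]
    simp only [mul_ite, mul_one, mul_zero, Finset.sum_ite_eq, Finset.sum_ite_eq', Finset.mem_univ,
      if_true]
    induction k using Fin.lastCases with
    | last =>
      have h1 : Finset.Ici (Fin.last d) = {Fin.last d} := by
        ext a; simp [Fin.last_le_iff]
      have h2 : Finset.Ici (0 : Fin (d + 1)) = Finset.univ := by
        ext a; simp
      rw [Fin.last_add_one, h1, h2, hx0]; simp
    | cast k =>
      have h1 : Finset.Ici k.castSucc = insert k.castSucc (Finset.Ici (k.castSucc + 1)) := by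
        ext a
        simp [Fin.le_def, Fin.ext_iff]
        omega
      rw [h1, Finset.sum_insert]
      · ring
      · simp [Fin.le_def]
  have hxS : x ∈ S := by
    rw [hx]; exact sum_mem fun i _ => hz _ i
  obtain ⟨l, hl, hsuml⟩ := AddSubmonoid.exists_list_of_mem_closure hxS
  clear hx hxS hx0
  induction l generalizing x with
  | nil => exact ⟨[], by simpa using hsuml⟩
  | cons a l ih =>
    obtain ⟨p, hp⟩ := ih l.sum (fun y hy => hl y (List.mem_cons_of_mem _ hy)) rfl
    obtain ⟨i, hi⟩ := hl a List.mem_cons_self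
    exact ⟨i :: p, by rw [List.map_cons, List.sum_cons, hp, hi, ← hsuml, List.sum_cons]⟩

lemma pV_const {d : ℕ} (hd : 1 ≤ d) {B : AddSubgroup (L d)} {C : Set (Arrow d B)}
    (γ : Fin (d + 1) → ℤ) (hC : IsCut d B C) (q : List (Fin (d + 1)))
    (hq : (q.map (alpha d)).sum ∈ B) (v : L d ⧸ B) :
    pV d B C γ q v = pV d B C γ q 0 := by
  induction v using QuotientAddGroup.induction_on with
  | H x =>
    obtain ⟨r, hr⟩ := exists_path x
    have := pV_perm hd γ hC (List.perm_append_comm (l₁ := q) (l₂ := r)) 0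
    rw [pV_append, pV_append, hr, (QuotientAddGroup.eq_zero_iff _).2 hq] at this
    simp only [zero_add, add_zero] at this
    linarith

lemma pV_sum {d : ℕ} {B : AddSubgroup (L d)} [B.FiniteIndex] [Fintype (L d ⧸ B)]
    {C : Set (Arrow d B)}
    (γ : Fin (d + 1) → ℤ) (htype : cutType d B C = γ) (q : List (Fin (d + 1))) :
    ∑ v : L d ⧸ B, pV d B C γ q v = 0 := by
  induction q with
  | nil => simp [pV]
  | cons i q ih =>
    simp only [pV, Finset.sum_add_distrib]
    have := Equiv.sum_comp (Equiv.addRight (QuotientAddGroup.mk (alpha d i) : L d ⧸ B))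
      (fun v => pV d B C γ q v)
    simp only [Equiv.coe_addRight] at this
    rw [this, ih, add_zero]
    have hg : γ i = ∑ v : L d ⧸ B, (if (v, i) ∈ C then (1 : ℤ) else 0) := by
      rw [← htype]
      simp only [cutType, Finset.sum_boole, Nat.card_eq_fintype_card, Fintype.card_subtype]
    simp only [aV, Finset.sum_sub_distrib, ← Finset.mul_sum, ← hg]
    simp [AddSubgroup.index, Nat.card_eq_fintype_card]

lemma pV_zero {d : ℕ} (hd : 1 ≤ d) {B : AddSubgroup (L d)} [B.FiniteIndex]
    {C : Set (Arrow d B)} (γ : Fin (d + 1) → ℤ) (hC : IsCut d B C)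
    (htype : cutType d B C = γ) (q : List (Fin (d + 1)))
    (hq : (q.map (alpha d)).sum ∈ B) (v : L d ⧸ B) :
    pV d B C γ q v = 0 := by
  have : Fintype (L d ⧸ B) := Fintype.ofFinite _
  have h := pV_sum γ htype q
  rw [Finset.sum_congr rfl fun v _ => pV_const hd γ hC q hq v] at h
  rw [pV_const hd γ hC q hq v]
  simpa using h

theorem fC_B_invariant_and_detector (d : ℕ) (hd : 1 ≤ d) (B : AddSubgroup (L d))
    [B.FiniteIndex] (γ : Fin (d + 1) → ℤ) (C : Set (Arrow d B))
    (hC : IsCut d B C) (htype : cutType d B C = γ) :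
    (∀ x y : L d, y ∈ B → ∀ p q : List (Fin (d + 1)),
      (p.map (alpha d)).sum = x → (q.map (alpha d)).sum = x + y →
      pathVal d (preim d B C) γ (B.index : ℤ) p 0 =
        pathVal d (preim d B C) γ (B.index : ℤ) q 0) ∧
    ∃ f : L d ⧸ B → ℤ, Detects d B C γ f ∧ IsCutDetector d B f γ := by
  have key : ∀ x y : L d, y ∈ B → ∀ p q : List (Fin (d + 1)),
      (p.map (alpha d)).sum = x → (q.map (alpha d)).sum = x + y →
      pathVal d (preim d B C) γ (B.index : ℤ) p 0 =
        pathVal d (preim d B C) γ (B.index : ℤ) q 0 := by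
    intro x y hy p q hp hq
    rw [pathVal_eq, pathVal_eq]
    obtain ⟨r, hr⟩ := exists_path (-x)
    have h1 := pV_zero hd γ hC htype (p ++ r) (by simp [hp, hr]) (QuotientAddGroup.mk 0)
    have h2 := pV_zero hd γ hC htype (q ++ r) (by simp [hq, hr, hy]) (QuotientAddGroup.mk 0)
    rw [pV_append, hp] at h1
    rw [pV_append, hq, QuotientAddGroup.mk_add, (QuotientAddGroup.eq_zero_iff y).2 hy,
      add_zero] at h2
    linarith
  refine ⟨key, ?_⟩
  choose P hP using fun x : L d => exists_path x
  have hdet : Detects d B C γ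
      (fun v => pathVal d (preim d B C) γ (B.index : ℤ) (P v.out) 0) := by
    intro x p hp
    have hmem : -x + (QuotientAddGroup.mk x : L d ⧸ B).out ∈ B := by
      rw [← QuotientAddGroup.eq]
      exact (QuotientAddGroup.out_eq' _).symm
    exact (key x _ hmem p _ hp (by rw [hP]; abel)).symm
  refine ⟨_, hdet, ?_, ?_⟩
  · exact hdet 0 [] rfl
  · intro x i
    rw [hdet x (P x) (hP x), hdet (x + alpha d i) (P x ++ [i]) (by simp [hP])]
    rw [pathVal_eq, pathVal_eq, pV_append]
    simp only [pV, aV]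
    split_ifs
    · right; ring
    · left; ring

end Paper
end
end

section
/- Let C be a cut of Q and γ = (γ_i)_{i=0}^d its type. For every (m_i)_{i=0}^d ∈ ℤ^{d+1} such that Σ_{i=0}^d m_iα_i ∈ B, one has Σ_{i=0}^d m_iγ_i ∈ mℤ. -/
open scoped Classical

noncomputable section

namespace Paper

theorem exists_perm_pair (e : ℕ) (i j : Fin (e + 2)) (hij : i ≠ j) :
    ∃ σ : Equiv.Perm (Fin (e + 2)), σ 0 = i ∧ σ 1 = j := by
  have ht : Equiv.swap 0 i 1 ≠ i := by
    intro h
    have h0 : Equiv.swap 0 i 0 = i := Equiv.swap_apply_left 0 i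
    have := (Equiv.swap 0 i).injective (h.trans h0.symm)
    exact absurd this (by simp)
  refine ⟨(Equiv.swap 0 i).trans (Equiv.swap (Equiv.swap 0 i 1) j), ?_, ?_⟩
  · simp only [Equiv.trans_apply, Equiv.swap_apply_left]
    exact Equiv.swap_apply_of_ne_of_ne ht.symm hij
  · simp only [Equiv.trans_apply, Equiv.swap_apply_left]

/-- The 0/1 indicator of the cut. -/
def chi (d : ℕ) (B : AddSubgroup (L d)) (C : Set (Arrow d B)) (i : Fin (d + 1))
    (a : L d ⧸ B) : ℤ := if (a, i) ∈ C then 1 else 0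

theorem sum_chi_cycle (d : ℕ) (B : AddSubgroup (L d)) (C : Set (Arrow d B))
    (hC : IsCut d B C) (x : L d) (σ : Equiv.Perm (Fin (d + 1))) :
    ∑ k, chi d B C (σ k)
      (QuotientAddGroup.mk (x + ∑ j ∈ Finset.Iio k, alpha d (σ j))) = 1 := by
  obtain ⟨k, hk, hu⟩ := hC x σ
  rw [Finset.sum_eq_single k]
  · exact if_pos hk
  · intro b _ hb
    exact if_neg fun h => hb (hu b h)
  · simp

theorem chi_comm (d : ℕ) (hd : 1 ≤ d) (B : AddSubgroup (L d)) (C : Set (Arrow d B))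
    (hC : IsCut d B C) (i j : Fin (d + 1)) (a : L d ⧸ B) :
    chi d B C i a + chi d B C j (a + QuotientAddGroup.mk (alpha d i)) =
      chi d B C j a + chi d B C i (a + QuotientAddGroup.mk (alpha d j)) := by
  by_cases hij : i = j
  · subst hij; rfl
  obtain ⟨e, rfl⟩ : ∃ e, d = e + 1 := ⟨d - 1, by omega⟩
  obtain ⟨σ, h0, h1⟩ := exists_perm_pair e i j hij
  obtain ⟨x, rfl⟩ := QuotientAddGroup.mk_surjective a
  have A1 := sum_chi_cycle _ B C hC x σ
  have A2 := sum_chi_cycle _ B C hC x ((Equiv.swap 0 1).trans σ)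
  have I0 : Finset.Iio (0 : Fin (e + 2)) = ∅ := by ext y; simp
  have I1 : Finset.Iio (1 : Fin (e + 2)) = {0} := by
    ext y; rw [Finset.mem_Iio, Finset.mem_singleton, Fin.lt_def, Fin.ext_iff, Fin.val_one, Fin.val_zero]; omega
  have key : ∀ k : Fin e, ∑ j ∈ Finset.Iio k.succ.succ, alpha (e + 1) (σ (Equiv.swap 0 1 j))
      = ∑ j ∈ Finset.Iio k.succ.succ, alpha (e + 1) (σ j) := by
    intro k
    refine Finset.sum_equiv (Equiv.swap 0 1) ?_ (fun _ _ => rfl)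
    intro y
    by_cases hy0 : y = 0
    · subst hy0; simp [Fin.lt_def]
    by_cases hy1 : y = 1
    · subst hy1; simp [Fin.lt_def]
    rw [Equiv.swap_apply_of_ne_of_ne hy0 hy1]
  have key2 : ∀ k : Fin e, Equiv.swap (0 : Fin (e + 2)) 1 k.succ.succ = k.succ.succ := by
    intro k
    apply Equiv.swap_apply_of_ne_of_ne <;> simp [Fin.ext_iff]
  rw [Fin.sum_univ_succ, Fin.sum_univ_succ] at A1 A2
  simp only [Equiv.trans_apply, key, key2, Fin.succ_zero_eq_one, I0, I1, Finset.sum_empty,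
    Finset.sum_singleton, Equiv.swap_apply_left, Equiv.swap_apply_right, h0, h1, add_zero,
    QuotientAddGroup.mk_add] at A1 A2
  linarith

theorem closure_alpha (d : ℕ) (H : AddSubgroup (L d)) (hH : ∀ i, alpha d i ∈ H) : H = ⊤ := by
  rw [eq_top_iff]
  rintro ⟨v, hv⟩ -
  let K : AddSubgroup (V d) := H.map (L d).subtype
  have hα : ∀ i : Fin (d + 1), (Pi.single i 1 - Pi.single (i - 1) 1 : V d) ∈ K :=
    fun i => ⟨alpha d i, hH i, rfl⟩
  have hz : ∀ i : Fin (d + 1), (Pi.single i 1 - Pi.single 0 1 : V d) ∈ K := by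
    intro i
    induction i using Fin.induction with
    | zero => simp
    | succ i ih =>
      have h := K.add_mem (hα i.succ) ih
      have e : i.succ - 1 = i.castSucc := by
        rw [sub_eq_iff_eq_add, Fin.coeSucc_eq_succ]
      rw [e] at h
      simpa using h
  have hs : ∑ i, v i = 0 := hv
  have hvK : v ∈ K := by
    have : v = ∑ i, v i • (Pi.single i 1 - Pi.single 0 1 : V d) := by
      simp only [smul_sub, Finset.sum_sub_distrib, ← Finset.sum_smul, hs, zero_smul, sub_zero]
      ext k
      simp [Finset.sum_apply, Pi.single_apply]
    rw [this]
    exact K.sum_mem fun i _ => K.zsmul_mem (hz i) _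
  obtain ⟨w, hw, hwv⟩ := hvK
  have : w = ⟨v, hv⟩ := Subtype.ext hwv
  exact this ▸ hw

/-- The homomorphism `ℤ^(d+1) → L/B`. -/
def piHom (d : ℕ) (B : AddSubgroup (L d)) : V d →+ L d ⧸ B :=
  (QuotientAddGroup.mk' B).comp (PhiG d (alpha d))

theorem piHom_single (d : ℕ) (B : AddSubgroup (L d)) (j : Fin (d + 1)) :
    piHom d B (Pi.single j 1) = QuotientAddGroup.mk (alpha d j) := by
  have : PhiG d (alpha d) (Pi.single j 1) = alpha d j := by
    show ∑ i, (Pi.single j 1 : V d) i • alpha d i = alpha d j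
    simp [Pi.single_apply, ite_smul]
  show QuotientAddGroup.mk' B (PhiG d (alpha d) (Pi.single j 1)) = _
  rw [this]; rfl

/-- Vectors for which the cocycle determined by `chi` exists. -/
def cocSub (d : ℕ) (B : AddSubgroup (L d)) [Fintype (L d ⧸ B)]
    (X : Fin (d + 1) → (L d ⧸ B) → ℤ) : AddSubgroup (V d) where
  carrier := {v | ∃ c : (L d ⧸ B) → ℤ, (∑ a, c a = ∑ i, v i * ∑ a, X i a) ∧
    ∀ i a, X i a + c (a + QuotientAddGroup.mk (alpha d i)) = c a + X i (a + piHom d B v)}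
  zero_mem' := ⟨0, by simp, by simp⟩
  add_mem' := by
    rintro v w ⟨c, hc, hc'⟩ ⟨c2, h2, h2'⟩
    refine ⟨fun a => c a + c2 (a + piHom d B v), ?_, ?_⟩
    · have := Equiv.sum_comp (Equiv.addRight (piHom d B v)) c2
      simp only [Equiv.coe_addRight] at this
      simp [Finset.sum_add_distrib, add_mul, hc, this, h2]
    · intro i a
      have e1 := hc' i a
      have e2 := h2' i (a + piHom d B v)
      show X i a + (c _ + c2 _) = (c a + c2 _) + X i _
      rw [map_add, ← add_assoc a, add_right_comm a (QuotientAddGroup.mk (alpha d i))]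
      linarith
  neg_mem' := by
    rintro v ⟨c, hc, hc'⟩
    refine ⟨fun a => - c (a - piHom d B v), ?_, ?_⟩
    · have := Equiv.sum_comp (Equiv.subRight (piHom d B v)) c
      simp only [Equiv.subRight_apply] at this
      simp [this, hc]
    · intro i a
      have e1 := hc' i (a - piHom d B v)
      rw [sub_add_cancel] at e1
      show X i a + -c _ = -c _ + X i _
      rw [map_neg, ← sub_eq_add_neg a, add_sub_right_comm]
      linarith

theorem cutType_dvd_rel (d : ℕ) (hd : 1 ≤ d) (B : AddSubgroup (L d)) [B.FiniteIndex]
    (C : Set (Arrow d B)) (hC : IsCut d B C)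
    (m' : Fin (d + 1) → ℤ) (hm' : (∑ i, m' i • alpha d i) ∈ B) :
    (B.index : ℤ) ∣ ∑ i, m' i * cutType d B C i := by
  have : Fintype (L d ⧸ B) := Fintype.ofFinite _
  have hγ : ∀ i, cutType d B C i = ∑ a, chi d B C i a := by
    intro i
    simp [cutType, chi, Fintype.card_subtype]
  have hmem : m' ∈ cocSub d B (chi d B C) := by
    have : m' = ∑ i, m' i • (Pi.single i 1 : V d) := by
      ext k
      simp [Finset.sum_apply, Pi.single_apply]
    rw [this]
    refine AddSubgroup.sum_mem _ fun j _ => AddSubgroup.zsmul_mem _ ?_ _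
    refine ⟨chi d B C j, ?_, ?_⟩
    · simp [Pi.single_apply]
    · intro i a
      rw [piHom_single]
      exact chi_comm d hd B C hC i j a
  obtain ⟨c, hc, hc'⟩ := hmem
  have hπ : piHom d B m' = 0 := (QuotientAddGroup.eq_zero_iff _).2 hm'
  have hinv : ∀ i a, c (a + QuotientAddGroup.mk (alpha d i)) = c a := by
    intro i a
    have := hc' i a
    rw [hπ, add_zero] at this
    linarith
  let H : AddSubgroup (L d) :=
    { carrier := {t | ∀ a, c (a + QuotientAddGroup.mk t) = c a}
      zero_mem' := by intro a; simp
      add_mem' := by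
        intro s t hs ht a
        rw [QuotientAddGroup.mk_add, ← add_assoc, ht, hs]
      neg_mem' := by
        intro s hs a
        have := hs (a + QuotientAddGroup.mk (-s))
        rw [← this, QuotientAddGroup.mk_neg, neg_add_cancel_right] }
  have hH : H = ⊤ := closure_alpha d H hinv
  have hconst : ∀ a, c a = c 0 := by
    intro a
    obtain ⟨x, rfl⟩ := QuotientAddGroup.mk_surjective a
    have hx : x ∈ H := hH ▸ AddSubgroup.mem_top x
    simpa using hx 0
  refine ⟨c 0, ?_⟩
  simp only [hγ]
  rw [← hc, Finset.sum_congr rfl fun a _ => hconst a]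
  simp [AddSubgroup.index, Nat.card_eq_fintype_card]

end Paper
end
end

section
/- Let C be a cut of Q and γ = (γ_i)_{i=0}^d its type. Then C is bounding, i.e., the quiver Q_C obtained from Q by deleting the arrows of C contains no cyclic path of positive length, if and only if γ_i > 0 for all 0 ≤ i ≤ d. -/
open scoped Classical

noncomputable section

namespace Paper

/-- Indicator of `C`. -/
def ind (d : ℕ) (B : AddSubgroup (L d)) (C : Set (Arrow d B)) (v : L d ⧸ B)
    (i : Fin (d + 1)) : ℕ := if (v, i) ∈ C then 1 else 0

/-- Number of arrows of `C` along a path. -/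
def cnt (d : ℕ) (B : AddSubgroup (L d)) (C : Set (Arrow d B)) :
    List (Fin (d + 1)) → (L d ⧸ B) → ℕ
  | [], _ => 0
  | i :: p, v => ind d B C v i + cnt d B C p (v + QuotientAddGroup.mk (alpha d i))

theorem exists_perm01 {n : ℕ} (i j : Fin (n + 2)) (h : i ≠ j) :
    ∃ σ : Equiv.Perm (Fin (n + 2)), σ 0 = i ∧ σ 1 = j := by
  set τ : Equiv.Perm (Fin (n + 2)) := Equiv.swap 0 i with hτ
  have h0 : τ 0 = i := by simp [hτ]
  have h1 : τ 1 ≠ i := by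
    intro e
    have := τ.injective (e.trans h0.symm)
    simp at this
  refine ⟨Equiv.swap (τ 1) j * τ, ?_, ?_⟩
  · rw [Equiv.Perm.mul_apply, h0]
    exact Equiv.swap_apply_of_ne_of_ne h1.symm h
  · rw [Equiv.Perm.mul_apply]
    exact Equiv.swap_apply_left _ _

theorem cut_sum (d : ℕ) (B : AddSubgroup (L d)) (C : Set (Arrow d B)) (hC : IsCut d B C)
    (x : L d) (σ : Equiv.Perm (Fin (d + 1))) :
    ∑ k, ind d B C (QuotientAddGroup.mk (x + ∑ j ∈ Finset.Iio k, alpha d (σ j))) (σ k) = 1 := by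
  obtain ⟨k, hk, hu⟩ := hC x σ
  rw [Finset.sum_eq_single k]
  · exact if_pos hk
  · intro b _ hb
    exact if_neg fun h => hb (hu b h)
  · simp

theorem ind_swap (d : ℕ) (hd : 1 ≤ d) (B : AddSubgroup (L d)) (C : Set (Arrow d B))
    (hC : IsCut d B C) (v : L d ⧸ B) (i j : Fin (d + 1)) :
    ind d B C v i + ind d B C (v + QuotientAddGroup.mk (alpha d i)) j =
    ind d B C v j + ind d B C (v + QuotientAddGroup.mk (alpha d j)) i := by
  by_cases hij : i = j
  · subst hij; rfl
  obtain ⟨n, rfl⟩ : ∃ n, d = n + 1 := ⟨d - 1, by omega⟩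
  obtain ⟨x, rfl⟩ := QuotientAddGroup.mk_surjective v
  obtain ⟨σ, h0, h1⟩ := exists_perm01 i j hij
  have e1 := cut_sum _ B C hC x σ
  have e2 := cut_sum _ B C hC x (σ * Equiv.swap 0 1)
  rw [Fin.sum_univ_succ, Fin.sum_univ_succ] at e1 e2
  have i0 : Finset.Iio (0 : Fin (n + 1 + 1)) = ∅ := by ext a; simp
  have i1 : Finset.Iio (1 : Fin (n + 1 + 1)) = {0} := by
    ext a; simp [Fin.lt_one_iff]
  have key : ∀ k : Fin n, ind (n+1) B C (QuotientAddGroup.mk (x + ∑ j ∈ Finset.Iio k.succ.succ,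
        alpha (n+1) ((σ * Equiv.swap 0 1 : Equiv.Perm (Fin (n+1+1))) j))) ((σ * Equiv.swap 0 1 : Equiv.Perm (Fin (n+1+1))) k.succ.succ)
      = ind (n+1) B C (QuotientAddGroup.mk (x + ∑ j ∈ Finset.Iio k.succ.succ,
        alpha (n+1) (σ j))) (σ k.succ.succ) := by
    intro k
    have hk : (Equiv.swap 0 1 : Equiv.Perm (Fin (n+2))) k.succ.succ = k.succ.succ := by
      apply Equiv.swap_apply_of_ne_of_ne
      · simp [Fin.ext_iff]
      · simp [Fin.ext_iff]
    have hs : ∑ j ∈ Finset.Iio k.succ.succ, alpha (n+1) ((σ * Equiv.swap 0 1 : Equiv.Perm (Fin (n+1+1))) j) =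
        ∑ j ∈ Finset.Iio k.succ.succ, alpha (n+1) (σ j) := by
      apply Finset.sum_equiv (Equiv.swap 0 1)
      · intro a
        simp only [Finset.mem_Iio]
        rw [Equiv.swap_apply_def]
        split_ifs with ha hb
        · subst ha; simp [Fin.lt_def]
        · subst hb; simp [Fin.lt_def]
        · rfl
      · intro a _; rfl
    rw [hs, Equiv.Perm.mul_apply, hk]
  rw [Finset.sum_congr rfl fun k _ => key k] at e2
  simp only [i0, Fin.succ_zero_eq_one, i1, Finset.sum_empty, Finset.sum_singleton,
    Equiv.Perm.mul_apply, Equiv.swap_apply_left, Equiv.swap_apply_right, h0, h1,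
    add_zero, QuotientAddGroup.mk_add] at e1 e2
  omega

theorem cnt_perm (d : ℕ) (hd : 1 ≤ d) (B : AddSubgroup (L d)) (C : Set (Arrow d B))
    (hC : IsCut d B C) {p q : List (Fin (d + 1))} (h : p.Perm q) :
    ∀ v, cnt d B C p v = cnt d B C q v := by
  induction h with
  | nil => intro v; rfl
  | cons a _ ih => intro v; simp only [cnt, ih]
  | swap a b l =>
    intro v
    simp only [cnt]
    have := ind_swap d hd B C hC v a b
    rw [add_right_comm v (QuotientAddGroup.mk (alpha d b))]
    omega
  | trans _ _ ih1 ih2 => intro v; rw [ih1, ih2]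

theorem cnt_append (d : ℕ) (B : AddSubgroup (L d)) (C : Set (Arrow d B))
    (j : Fin (d + 1)) (p : List (Fin (d + 1))) : ∀ v,
    cnt d B C (p ++ [j]) v = cnt d B C p v +
      ind d B C (v + QuotientAddGroup.mk ((p.map (alpha d)).sum)) j := by
  induction p with
  | nil => intro v; simp [cnt]
  | cons a p ih =>
    intro v
    simp only [List.cons_append, cnt, ih, List.map_cons, List.sum_cons, QuotientAddGroup.mk_add,
      add_assoc]

theorem cnt_avoids (d : ℕ) (B : AddSubgroup (L d)) (C : Set (Arrow d B))
    (p : List (Fin (d + 1))) : ∀ v, avoids d B C p v → cnt d B C p v = 0 := by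
  induction p with
  | nil => intro v _; rfl
  | cons a p ih =>
    intro v h
    simp only [cnt, ih _ h.2, ind, if_neg h.1]

theorem alpha_gen (d : ℕ) : AddSubgroup.closure (Set.range (alpha d)) = ⊤ := by
  set H := AddSubgroup.closure (Set.range (alpha d)) with hH
  have h1 : ∀ k : Fin (d + 1), ∃ y ∈ H, (y : V d) = Pi.single k 1 - Pi.single 0 1 := by
    intro k
    induction k using Fin.induction with
    | zero => exact ⟨0, H.zero_mem, by simp⟩
    | succ k ih =>
      obtain ⟨y, hy, e⟩ := ih
      refine ⟨alpha d k.succ + y, H.add_mem (AddSubgroup.subset_closure ⟨_, rfl⟩) hy, ?_⟩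
      have hk : k.succ - 1 = k.castSucc := by
        rw [sub_eq_iff_eq_add]; simp
      simp only [AddSubgroup.coe_add, e, alpha, hk]
      abel
  choose y hy e using h1
  rw [eq_top_iff]
  intro x _
  have hx : x = ∑ k, (x : V d) k • y k := by
    apply Subtype.ext
    have hs : ∑ k, (x : V d) k = 0 := x.2
    rw [AddSubgroup.val_finsetSum]
    simp only [AddSubgroup.coe_zsmul, e, smul_sub, Finset.sum_sub_distrib, ← Finset.sum_smul, hs,
      zero_smul, sub_zero]
    ext a
    simp [Finset.sum_apply, Pi.single_apply]
  rw [hx]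
  exact H.sum_mem fun k _ => H.zsmul_mem (hy k) _

theorem sum_cnt (d : ℕ) (B : AddSubgroup (L d)) [Fintype (L d ⧸ B)] (C : Set (Arrow d B))
    (p : List (Fin (d + 1))) :
    ∑ v, cnt d B C p v = (p.map fun i => ∑ v, ind d B C v i).sum := by
  induction p with
  | nil => simp [cnt]
  | cons a p ih =>
    simp only [cnt, Finset.sum_add_distrib, List.map_cons, List.sum_cons, ← ih]
    congr 1
    exact Equiv.sum_comp (Equiv.addRight (QuotientAddGroup.mk (alpha d a) : L d ⧸ B))
      (cnt d B C p)

theorem avoids_replicate (d : ℕ) (B : AddSubgroup (L d)) (C : Set (Arrow d B))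
    (i : Fin (d + 1)) (h : ∀ v, (v, i) ∉ C) (n : ℕ) :
    ∀ v, avoids d B C (List.replicate n i) v := by
  induction n with
  | zero => intro v; trivial
  | succ n ih => intro v; exact ⟨h v, ih _⟩

theorem bounding_iff_type_pos (d : ℕ) (hd : 1 ≤ d) (B : AddSubgroup (L d)) [B.FiniteIndex]
    (C : Set (Arrow d B)) (hC : IsCut d B C) :
    IsBounding d B C ↔ ∀ i, 0 < cutType d B C i := by
  have : Fintype (L d ⧸ B) := Fintype.ofFinite _
  constructor
  · intro hb i
    by_contra hi
    have hi0 : Nat.card {v : L d ⧸ B // (v, i) ∈ C} = 0 := by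
      unfold cutType at hi
      omega
    have hemp : ∀ v, (v, i) ∉ C := by
      intro v hv
      rw [Nat.card_eq_zero] at hi0
      rcases hi0 with h | h
      · exact h.false ⟨v, hv⟩
      · exact h.not_finite inferInstance
    apply hb
    refine ⟨0, List.replicate (Nat.card (L d ⧸ B)) i, ?_, avoids_replicate d B C i hemp _ _, ?_⟩
    · have : Nat.card (L d ⧸ B) ≠ 0 := Nat.card_pos.ne'
      simpa using this
    · rw [List.map_replicate, List.sum_replicate, QuotientAddGroup.mk_nsmul, card_nsmul_eq_zero',
        zero_add]
  · rintro hpos ⟨v, p, hp, hav, hcl⟩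
    have hcl0 : (QuotientAddGroup.mk ((p.map (alpha d)).sum) : L d ⧸ B) = 0 := by
      simpa using hcl
    have step : ∀ w j, cnt d B C p (w + QuotientAddGroup.mk (alpha d j)) = cnt d B C p w := by
      intro w j
      have h1 := cnt_append d B C j p w
      have h2 := cnt_perm d hd B C hC (List.perm_append_singleton j p) w
      rw [hcl0, add_zero] at h1
      simp only [cnt] at h2
      omega
    have const : ∀ x : L d, ∀ w, cnt d B C p (w + QuotientAddGroup.mk x) = cnt d B C p w := by
      intro x
      have hx : x ∈ AddSubgroup.closure (Set.range (alpha d)) := by rw [alpha_gen]; trivial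
      induction hx using AddSubgroup.closure_induction with
      | mem x hx => obtain ⟨j, rfl⟩ := hx; exact fun w => step w j
      | zero => intro w; simp
      | add x y _ _ hx hy =>
        intro w
        rw [QuotientAddGroup.mk_add, ← add_assoc, hy, hx]
      | neg x _ hx =>
        intro w
        rw [← hx (w + QuotientAddGroup.mk (-x)), add_assoc, ← QuotientAddGroup.mk_add]
        simp
    have hz : ∀ w, cnt d B C p w = 0 := by
      intro w
      obtain ⟨x, hx⟩ := QuotientAddGroup.mk_surjective (w - v)
      have := const x v
      rw [hx, add_sub_cancel, cnt_avoids d B C p v hav] at this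
      exact this
    have hs := sum_cnt d B C p
    rw [Finset.sum_eq_zero fun w _ => hz w] at hs
    obtain ⟨a, q, rfl⟩ := List.exists_cons_of_ne_nil hp
    rw [List.map_cons, List.sum_cons] at hs
    have ha : ∑ w, ind d B C w a = 0 := by omega
    have hpa := hpos a
    unfold cutType at hpa
    have hne : Nat.card {v : L d ⧸ B // (v, a) ∈ C} ≠ 0 := by omega
    obtain ⟨⟨w, hw⟩⟩ := (Nat.card_ne_zero.mp hne).1
    have := Finset.sum_eq_zero_iff.mp ha w (Finset.mem_univ _)
    simp [ind, hw] at this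

end Paper
end
end

section
/- For γ = (γ_i)_{i=0}^d ∈ ℤ_{≥0}^{d+1}, there exists a cut of Q of type γ if and only if both of the following hold: (1) Σ_{i=0}^d γ_i = m; (2) for every (m_i)_{i=0}^d ∈ ℤ^{d+1} with Σ_{i=0}^d m_iα_i ∈ B, one has Σ_{i=0}^d m_iγ_i ∈ mℤ. -/
open scoped Classical

noncomputable section

namespace Paper

/-! helper lemmas -/

theorem sum_alpha (d : ℕ) : ∑ i, alpha d i = 0 := by
  apply Subtype.ext
  have h : (((∑ i, alpha d i : L d)) : V d) = ∑ i, ((alpha d i : L d) : V d) := by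
    simp
  rw [h]
  simp only [alpha, Finset.sum_sub_distrib, ZeroMemClass.coe_zero]
  rw [sub_eq_zero]
  exact ((Equiv.subRight (1 : Fin (d + 1))).sum_comp
    (fun i => (Pi.single i 1 : V d))).symm

theorem alpha_span (d : ℕ) (x : L d) : ∃ n : Fin (d + 1) → ℤ, x = ∑ i, n i • alpha d i := by
  have hx : ∑ i, (x : V d) i = 0 := x.2
  refine ⟨fun j => ∑ k ∈ Finset.Ici j, (x : V d) k, ?_⟩
  apply Subtype.ext
  funext j
  set n : Fin (d + 1) → ℤ := fun j => ∑ k ∈ Finset.Ici j, (x : V d) k with hn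
  have h : ((∑ i, n i • alpha d i : L d) : V d) j = n j - n (j + 1) := by
    have h1 : ((∑ i, n i • alpha d i : L d) : V d) = ∑ i, n i • ((alpha d i : L d) : V d) := by
      simp
    rw [h1, Finset.sum_apply]
    have h2 : ∀ i, (n i • ((alpha d i : L d) : V d)) j
        = (if i = j then n i else 0) - (if i = j + 1 then n i else 0) := by
      intro i
      have e1 : (j = i) ↔ (i = j) := eq_comm
      have e2 : (j = i - 1) ↔ (i = j + 1) := by
        rw [eq_sub_iff_add_eq, eq_comm]
      simp [alpha, Pi.single_apply, mul_sub, e1, e2]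
    rw [Finset.sum_congr rfl fun i _ => h2 i, Finset.sum_sub_distrib]
    simp
  refine Eq.trans ?_ h.symm
  by_cases hj : j = Fin.last d
  · subst hj
    have h0 : n (Fin.last d + 1) = 0 := by
      rw [Fin.last_add_one]
      simp only [hn]
      rw [← hx]
      apply Finset.sum_congr _ fun _ _ => rfl
      ext k; simp
    rw [h0]
    have : Finset.Ici (Fin.last d) = {Fin.last d} := by
      ext k; simp [Fin.last_le_iff]
    simp [hn, this]
  · have hlt : j < Fin.last d := lt_of_le_of_ne (Fin.le_last j) hj
    have : Finset.Ici j = insert j (Finset.Ici (j + 1)) := by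
      ext k
      simp only [Finset.mem_Ici, Finset.mem_insert, Fin.le_def, Fin.ext_iff,
        Fin.val_add_one_of_lt hlt]
      omega
    simp only [hn]
    rw [this, Finset.sum_insert]
    · ring
    · simp only [Finset.mem_Ici, Fin.le_def, Fin.val_add_one_of_lt hlt]
      omega

theorem existsUnique_iff_sum {ι : Type*} [Fintype ι] (P : ι → Prop) :
    (∃! k, P k) ↔ ∑ k, (if P k then (1 : ℤ) else 0) = 1 := by
  rw [Finset.sum_boole]
  have h : ((Finset.card (Finset.univ.filter P) : ℤ) = 1) ↔ Finset.card (Finset.univ.filter P) = 1 := by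
    norm_cast
  rw [h, Finset.card_eq_one]
  constructor
  · rintro ⟨k, hk, hu⟩
    refine ⟨k, ?_⟩
    ext y
    simp only [Finset.mem_filter, Finset.mem_univ, true_and, Finset.mem_singleton]
    exact ⟨fun hy => hu y hy, fun hy => hy ▸ hk⟩
  · rintro ⟨k, hk⟩
    have hm : ∀ y, P y ↔ y = k := by
      intro y
      have := Finset.ext_iff.mp hk y
      simpa using this
    exact ⟨k, (hm k).2 rfl, fun y hy => (hm y).1 hy⟩

theorem isCut_iff (d : ℕ) (B : AddSubgroup (L d)) (C : Set (Arrow d B)) :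
    IsCut d B C ↔ ∀ (x : L d ⧸ B) (σ : Equiv.Perm (Fin (d + 1))),
      ∑ k, (if (x + ∑ j ∈ Finset.Iio k, (QuotientAddGroup.mk (alpha d (σ j)) : L d ⧸ B), σ k) ∈ C
        then (1 : ℤ) else 0) = 1 := by
  have key : ∀ (x : L d) (σ : Equiv.Perm (Fin (d + 1))) (k : Fin (d + 1)),
      ((x + ∑ j ∈ Finset.Iio k, alpha d (σ j), σ k) ∈ preim d B C) ↔
      (((x : L d ⧸ B) + ∑ j ∈ Finset.Iio k, (QuotientAddGroup.mk (alpha d (σ j)) : L d ⧸ B), σ k)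
        ∈ C) := by
    intro x σ k
    have : ((x + ∑ j ∈ Finset.Iio k, alpha d (σ j) : L d) : L d ⧸ B)
        = (x : L d ⧸ B) + ∑ j ∈ Finset.Iio k, (QuotientAddGroup.mk (alpha d (σ j)) : L d ⧸ B) := by
      rw [QuotientAddGroup.mk_add]
      congr 1
      exact map_sum (QuotientAddGroup.mk' B) _ _
    simp only [preim, Set.mem_ofPred_eq, this]
  constructor
  · intro h x σ
    obtain ⟨x, rfl⟩ := QuotientAddGroup.mk_surjective x
    rw [← existsUnique_iff_sum]
    have := h x σ
    simpa only [key] using this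
  · intro h x σ
    simp only [key]
    rw [existsUnique_iff_sum]
    exact h x σ

theorem curl_free {A : Type*} [AddCommGroup A] (d : ℕ) (a : Fin (d + 2) → A)
    (c : A → Fin (d + 2) → ℤ)
    (h : ∀ (x : A) (σ : Equiv.Perm (Fin (d + 2))),
      ∑ k, c (x + ∑ j ∈ Finset.Iio k, a (σ j)) (σ k) = 1)
    (x : A) (i j : Fin (d + 2)) : c x i + c (x + a i) j = c x j + c (x + a j) i := by
  by_cases hij : i = j
  · subst hij; rfl
  obtain ⟨σ, h0, h1⟩ : ∃ σ : Equiv.Perm (Fin (d + 2)), σ 0 = i ∧ σ 1 = j := by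
    refine ⟨Equiv.swap 0 i * Equiv.swap 1 (Equiv.swap 0 i j), ?_, ?_⟩
    · rw [Equiv.Perm.mul_apply, Equiv.swap_apply_of_ne_of_ne (a := 1), Equiv.swap_apply_left]
      · simp
      · intro h'
        have := congrArg (Equiv.swap 0 i) h'
        simp at this
        exact hij this
    · rw [Equiv.Perm.mul_apply, Equiv.swap_apply_left]; simp [← Equiv.Perm.mul_apply]
  have e0 : Finset.Iio (0 : Fin (d + 2)) = ∅ := by
    ext k; simp
  have e1 : Finset.Iio (1 : Fin (d + 2)) = {0} := by
    ext k
    simp only [Finset.mem_Iio, Finset.mem_singleton, Fin.lt_def, Fin.ext_iff, Fin.val_one, Fin.val_zero]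
    omega
  have H1 := h x σ
  have H2 := h x (σ * Equiv.swap 0 1)
  rw [Fin.sum_univ_succ, Fin.sum_univ_succ] at H1 H2
  simp only [Fin.succ_zero_eq_one, e0, e1, Finset.sum_empty, Finset.sum_singleton, add_zero,
    Equiv.Perm.mul_apply, Equiv.swap_apply_left, Equiv.swap_apply_right, h0, h1] at H1 H2
  have H3 : ∀ k : Fin d,
      c (x + ∑ j ∈ Finset.Iio k.succ.succ, a (σ (Equiv.swap 0 1 j)))
        (σ (Equiv.swap 0 1 k.succ.succ)) =
      c (x + ∑ j ∈ Finset.Iio k.succ.succ, a (σ j)) (σ k.succ.succ) := by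
    intro k
    have hs : Equiv.swap (0 : Fin (d + 2)) 1 k.succ.succ = k.succ.succ :=
      Equiv.swap_apply_of_ne_of_ne (by simp [Fin.ext_iff]) (by simp [Fin.ext_iff])
    rw [hs]
    congr 2
    refine Finset.sum_equiv (Equiv.swap 0 1) ?_ (fun _ _ => rfl)
    intro l
    simp only [Finset.mem_Iio]
    rcases eq_or_ne l 0 with rfl | hl0
    · simp [Fin.lt_def]
    rcases eq_or_ne l 1 with rfl | hl1
    · simp [Fin.lt_def]
    rw [Equiv.swap_apply_of_ne_of_ne hl0 hl1]
  rw [Finset.sum_congr rfl fun k _ => H3 k] at H2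
  linarith

theorem cocycle_dvd {A : Type*} [AddCommGroup A] [Fintype A] {n : ℕ} (a : Fin n → A)
    (c : A → Fin n → ℤ)
    (hc : ∀ (x : A) (i j : Fin n), c x i + c (x + a i) j = c x j + c (x + a j) i)
    (hgen : ∀ x : A, ∃ m : Fin n → ℤ, x = ∑ i, m i • a i)
    (m : Fin n → ℤ) (hm : ∑ i, m i • a i = 0) :
    (Fintype.card A : ℤ) ∣ ∑ i, m i * ∑ x, c x i := by
  let S : AddSubgroup (Fin n → ℤ) :=
    { carrier := {m | ∃ F : A → ℤ,
        (∀ j x, F (x + a j) - F x = c (x + ∑ i, m i • a i) j - c x j) ∧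
          ∑ x, F x = ∑ i, m i * ∑ x, c x i}
      zero_mem' := ⟨fun _ => 0, by simp⟩
      add_mem' := by
        rintro m m' ⟨F, h1, h2⟩ ⟨F', h1', h2'⟩
        refine ⟨fun x => F x + F' (x + ∑ i, m i • a i), ?_, ?_⟩
        · intro j x
          have e1 := h1 j x
          have e2 := h1' j (x + ∑ i, m i • a i)
          have e3 : x + a j + ∑ i, m i • a i = x + ∑ i, m i • a i + a j := by abel
          have e4 : ∑ i, (m + m') i • a i = ∑ i, m i • a i + ∑ i, m' i • a i := by
            simp [add_smul, Finset.sum_add_distrib]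
          simp only [e3, e4, ← add_assoc]
          linarith
        · rw [Finset.sum_add_distrib, h2,
            Fintype.sum_equiv (Equiv.addRight (∑ i, m i • a i))
              (fun x => F' (x + ∑ i, m i • a i)) F' (fun _ => rfl), h2']
          simp [add_mul, Finset.sum_add_distrib]
      neg_mem' := by
        rintro m ⟨F, h1, h2⟩
        refine ⟨fun x => - F (x - ∑ i, m i • a i), ?_, ?_⟩
        · intro j x
          have e1 := h1 j (x - ∑ i, m i • a i)
          have e3 : x + a j - ∑ i, m i • a i = x - ∑ i, m i • a i + a j := by abel
          have e4 : x + ∑ i, (-m) i • a i = x - ∑ i, m i • a i := by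
            simp [sub_eq_add_neg]
          simp only [e3, e4]
          rw [sub_add_cancel] at e1
          linarith
        · rw [Finset.sum_neg_distrib, Fintype.sum_equiv (Equiv.subRight (∑ i, m i • a i))
              (fun x => F (x - ∑ i, m i • a i)) F (fun _ => by simp), h2]
          simp }
  have hS : ∀ i, Pi.single i 1 ∈ S := by
    intro i
    refine ⟨fun x => c x i, ?_, ?_⟩
    · intro j x
      have : ∑ k, (Pi.single i 1 : Fin n → ℤ) k • a k = a i := by
        simp [Pi.single_apply, ite_smul]
      rw [this]
      have := hc x i j
      linarith
    · simp [Pi.single_apply]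
  have hmS : m ∈ S := by
    have : m = ∑ i, m i • (Pi.single i 1 : Fin n → ℤ) := by
      funext k
      simp [Finset.sum_apply, Pi.single_apply]
    rw [this]
    exact S.sum_mem fun i _ => S.zsmul_mem (hS i) _
  obtain ⟨F, h1, h2⟩ := hmS
  have hper : ∀ j x, F (x + a j) = F x := by
    intro j x
    have := h1 j x
    rw [hm, add_zero] at this
    linarith
  let T : AddSubgroup A :=
    { carrier := {y | ∀ x, F (x + y) = F x}
      zero_mem' := by simp
      add_mem' := by
        intro y z hy hz x
        rw [← add_assoc, hz, hy]
      neg_mem' := by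
        intro y hy x
        have := hy (x + -y)
        rw [neg_add_cancel_right] at this
        exact this.symm }
  have hconst : ∀ y, F y = F 0 := by
    intro y
    obtain ⟨k, hk⟩ := hgen y
    have : y ∈ T := by
      rw [hk]
      exact T.sum_mem fun i _ => T.zsmul_mem (fun x => hper i x) _
    simpa using this 0
  rw [← h2, Finset.sum_congr rfl fun y _ => hconst y]
  simp

theorem telescope {A : Type*} [AddCommGroup A] (d : ℕ) (b : Fin (d + 1) → A)
    (hb : ∑ i, b i = 0) (f : A → ℤ) (x : A) :
    ∑ k, (f (x + ∑ j ∈ Finset.Iio k, b j + b k) - f (x + ∑ j ∈ Finset.Iio k, b j)) = 0 := by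
  let g : ℕ → ℤ := fun n => f (x + ∑ j ∈ Finset.univ.filter (fun j : Fin (d + 1) => j.val < n), b j)
  have h1 : ∀ k : Fin (d + 1), f (x + ∑ j ∈ Finset.Iio k, b j) = g k := by
    intro k
    simp only [g]
    congr 3
    ext j; simp only [Finset.mem_Iio, Finset.mem_filter, Finset.mem_univ, true_and, Fin.lt_def]
  have h2 : ∀ k : Fin (d + 1), f (x + ∑ j ∈ Finset.Iio k, b j + b k) = g (k + 1) := by
    intro k
    have : Finset.univ.filter (fun j : Fin (d + 1) => j.val < k.val + 1)
        = insert k (Finset.Iio k) := by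
      ext j; simp only [Finset.mem_filter, Finset.mem_univ, true_and, Finset.mem_insert,
        Finset.mem_Iio, Fin.lt_def, Fin.ext_iff]; omega
    simp only [g]
    rw [this, Finset.sum_insert (by simp), add_assoc, add_comm (b k)]
  rw [Finset.sum_congr rfl fun k _ => by rw [h1 k, h2 k],
    Fin.sum_univ_eq_sum_range (fun k => g (k + 1) - g k), Finset.sum_range_sub]
  have e1 : Finset.univ.filter (fun j : Fin (d + 1) => j.val < d + 1) = Finset.univ := by
    ext j; simp only [Finset.mem_filter, Finset.mem_univ, true_and, j.isLt]
  simp only [g]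
  rw [e1, hb]
  simp

set_option maxHeartbeats 1000000 in
theorem exists_cut_of_type_iff (d : ℕ) (hd : 1 ≤ d) (B : AddSubgroup (L d)) [B.FiniteIndex]
    (γ : Fin (d + 1) → ℤ) (hγ : ∀ i, 0 ≤ γ i) :
    (∃ C : Set (Arrow d B), IsCut d B C ∧ cutType d B C = γ) ↔
      ((∑ i, γ i) = (B.index : ℤ) ∧
        ∀ m' : Fin (d + 1) → ℤ, (∑ i, m' i • alpha d i) ∈ B →
          (B.index : ℤ) ∣ ∑ i, m' i * γ i) := by
  have : Finite (L d ⧸ B) := inferInstance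
  have : Fintype (L d ⧸ B) := Fintype.ofFinite _
  have hcard : (B.index : ℤ) = (Fintype.card (L d ⧸ B) : ℤ) := by
    rw [AddSubgroup.index, Nat.card_eq_fintype_card]
  have hmk : ∀ n : Fin (d + 1) → ℤ, ((∑ i, n i • alpha d i : L d) : L d ⧸ B)
      = ∑ i, n i • (QuotientAddGroup.mk (alpha d i) : L d ⧸ B) := by
    intro n
    have := map_sum (QuotientAddGroup.mk' B) (fun i => n i • alpha d i) Finset.univ
    simpa only [map_zsmul, QuotientAddGroup.mk'_apply] using this
  have hsum0 : ∑ i, (QuotientAddGroup.mk (alpha d i) : L d ⧸ B) = 0 := by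
    have := map_sum (QuotientAddGroup.mk' B) (fun i => alpha d i) Finset.univ
    rw [sum_alpha, map_zero] at this
    exact this.symm
  have htype : ∀ (C : Set (Arrow d B)) (i : Fin (d + 1)),
      cutType d B C i = ∑ v : L d ⧸ B, if (v, i) ∈ C then (1 : ℤ) else 0 := by
    intro C i
    rw [Finset.sum_boole, cutType, Nat.card_eq_fintype_card, Fintype.card_subtype]
  constructor
  · rintro ⟨C, hC, rfl⟩
    rw [isCut_iff] at hC
    simp only [htype]
    constructor
    · have h1 : ∑ x : L d ⧸ B, ∑ k : Fin (d + 1),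
          (if (x + ∑ j ∈ Finset.Iio k, (QuotientAddGroup.mk (alpha d j) : L d ⧸ B), k) ∈ C
            then (1 : ℤ) else 0) = Fintype.card (L d ⧸ B) := by
        refine (Finset.sum_congr rfl fun x _ => hC x (Equiv.refl _)).trans ?_
        simp
      rw [Finset.sum_comm] at h1
      rw [hcard, ← h1]
      refine Finset.sum_congr rfl fun k _ => ?_
      exact (Fintype.sum_equiv (Equiv.addRight (∑ j ∈ Finset.Iio k,
        (QuotientAddGroup.mk (alpha d j) : L d ⧸ B))) _
          (fun v => if (v, k) ∈ C then (1 : ℤ) else 0) (fun _ => rfl)).symm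
    · intro m' hm'
      rw [hcard]
      obtain ⟨e, rfl⟩ : ∃ e, d = e + 1 := ⟨d - 1, by omega⟩
      refine cocycle_dvd (fun i => (QuotientAddGroup.mk (alpha (e + 1) i) : L (e + 1) ⧸ B))
        (fun v i => if (v, i) ∈ C then (1 : ℤ) else 0)
        (curl_free e _ _ hC) ?_ m' ?_
      · intro x
        obtain ⟨x, rfl⟩ := QuotientAddGroup.mk_surjective x
        obtain ⟨n, hn⟩ := alpha_span (e + 1) x
        exact ⟨n, by rw [← hmk, ← hn]⟩
      · rw [← hmk]
        exact (QuotientAddGroup.eq_zero_iff _).2 hm'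
  · rintro ⟨hs, hdvd⟩
    have hgen : ∀ v : L d ⧸ B, ∃ n : Fin (d + 1) → ℤ,
        v = ∑ i, n i • (QuotientAddGroup.mk (alpha d i) : L d ⧸ B) := by
      intro x
      obtain ⟨x, rfl⟩ := QuotientAddGroup.mk_surjective x
      obtain ⟨n, hn⟩ := alpha_span d x
      exact ⟨n, by rw [← hmk, ← hn]⟩
    choose N hN using hgen
    have hpos : (0 : ℤ) < B.index := by
      have := AddSubgroup.FiniteIndex.index_ne_zero (H := B)
      omega
    set m : ℤ := (B.index : ℤ) with hm
    let f : L d ⧸ B → ℤ := fun v => (∑ i, N v i * γ i) % m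
    have hf0 : ∀ v, 0 ≤ f v := fun v => Int.emod_nonneg _ hpos.ne'
    have hf1 : ∀ v, f v < m := fun v => Int.emod_lt_of_pos _ hpos
    have hle : ∀ i, γ i ≤ m := by
      intro i
      rw [← hs]
      exact Finset.single_le_sum (fun j _ => hγ j) (Finset.mem_univ i)
    have hcong : ∀ v i, m ∣ f (v + QuotientAddGroup.mk (alpha d i)) - (f v + γ i) := by
      intro v i
      set w : L d ⧸ B := v + QuotientAddGroup.mk (alpha d i) with hw
      have h1 := hdvd (N w - N v - Pi.single i 1) (by
        rw [← QuotientAddGroup.eq_zero_iff, hmk]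
        simp only [Pi.sub_apply, sub_smul, Finset.sum_sub_distrib, ← hN]
        simp [Pi.single_apply, hw])
      simp only [Pi.sub_apply, sub_mul, Finset.sum_sub_distrib] at h1
      have h2 : ∑ x, (Pi.single i 1 : Fin (d + 1) → ℤ) x * γ x = γ i := by
        simp [Pi.single_apply]
      rw [h2] at h1
      have h3 : m ∣ (∑ i, N w i * γ i) - f w := Int.dvd_self_sub_emod
      have h4 : m ∣ (∑ i, N v i * γ i) - f v := Int.dvd_self_sub_emod
      obtain ⟨q1, h1⟩ := h1
      obtain ⟨q3, h3⟩ := h3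
      obtain ⟨q4, h4⟩ := h4
      exact ⟨q1 - q3 + q4, by linarith⟩
    have hstep : ∀ v i, f (v + QuotientAddGroup.mk (alpha d i)) - f v
        = γ i - m * (if f (v + QuotientAddGroup.mk (alpha d i)) = f v + γ i - m
            then 1 else 0) := by
      intro v i
      obtain ⟨q, hq⟩ := hcong v i
      have a1 := hf0 v
      have a2 := hf1 v
      have a3 := hf0 (v + QuotientAddGroup.mk (alpha d i))
      have a4 := hf1 (v + QuotientAddGroup.mk (alpha d i))
      have a5 := hγ i
      have a6 := hle i
      have q1 : q < 1 := by
        by_contra hcon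
        have : m * 1 ≤ m * q := mul_le_mul_of_nonneg_left (by omega) hpos.le
        omega
      have q2 : -2 < q := by
        by_contra hcon
        have : m * q ≤ m * (-2) := mul_le_mul_of_nonneg_left (by omega) hpos.le
        omega
      have : q = 0 ∨ q = -1 := by omega
      rcases this with rfl | rfl
      · rw [if_neg (by omega)]; omega
      · rw [if_pos (by omega)]; omega
    clear hf0 hf1 hcong
    clear_value f
    obtain ⟨C, hCdef⟩ : ∃ C : Set (Arrow d B), ∀ v i, (v, i) ∈ C ↔
        f (v + QuotientAddGroup.mk (alpha d i)) = f v + γ i - m :=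
      ⟨{p | f (p.1 + QuotientAddGroup.mk (alpha d p.2)) = f p.1 + γ p.2 - m}, by
        intro v i
        rw [Set.mem_ofPred_eq]⟩
    have hstepC : ∀ v i, f (v + QuotientAddGroup.mk (alpha d i)) - f v
        = γ i - m * (if (v, i) ∈ C then 1 else 0) := by
      intro v i
      simp only [hCdef]
      convert hstep v i
    refine ⟨C, ?_, ?_⟩
    · rw [isCut_iff]
      intro x σ
      have hσ : ∑ j, (QuotientAddGroup.mk (alpha d (σ j)) : L d ⧸ B) = 0 := by
        rw [← hsum0]
        exact Equiv.sum_comp σ (fun j => (QuotientAddGroup.mk (alpha d j) : L d ⧸ B))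
      have ht := telescope d (fun j => (QuotientAddGroup.mk (alpha d (σ j)) : L d ⧸ B)) hσ f x
      rw [Finset.sum_congr rfl fun k _ => hstepC _ (σ k), Finset.sum_sub_distrib,
        Equiv.sum_comp σ γ, hs, ← Finset.mul_sum] at ht
      have : m * (∑ k, (if (x + ∑ j ∈ Finset.Iio k,
        (QuotientAddGroup.mk (alpha d (σ j)) : L d ⧸ B), σ k) ∈ C
        then (1 : ℤ) else 0)) = m * 1 := by linarith
      exact mul_left_cancel₀ hpos.ne' this
    · funext i
      rw [htype]
      have h1 : ∑ v : L d ⧸ B, (f (v + QuotientAddGroup.mk (alpha d i)) - f v) = 0 := by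
        rw [Finset.sum_sub_distrib, sub_eq_zero]
        exact Fintype.sum_equiv (Equiv.addRight (QuotientAddGroup.mk (alpha d i) : L d ⧸ B)) _ f
          (fun _ => rfl)
      rw [Finset.sum_congr rfl fun v _ => hstepC v i, Finset.sum_sub_distrib,
        ← Finset.mul_sum, Finset.sum_const, Finset.card_univ, nsmul_eq_mul, ← hcard] at h1
      apply mul_left_cancel₀ hpos.ne'
      linarith

end Paper
end
end
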